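/- Let θ₁, θ₂ ∈ ℝ be irrational and let θ be a nonzero real number. Then the following are equivalent: (i) for all nonzero complex numbers x, x', y, y' with C_θ(x, y) and C_θ(x', y'), one has x'/x ∈ Γ_{θ₁} if and only if y'/y ∈ Γ_{θ₂}; (ii) θ·(ℤθ₁ + ℤ) = ℤθ₂ + ℤ as subsets of ℝ. -/

import Mathlib

/-- The multivalued relation `y = x^θ`: there is `z` with `x = exp z` and `y = exp (θ z)`. -/
def Crel (θ : ℝ) (x y : ℂ) : Prop :=
  ∃ z : ℂ, x = Complex.exp z ∧ y = Complex.exp ((θ : ℂ) * z)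

/-- `exp(2 π i α)`. -/
noncomputable def qexp (α : ℝ) : ℂ := Complex.exp (2 * (Real.pi : ℂ) * Complex.I * (α : ℝ))

/-- The cyclic subgroup `Γ_α = {exp(2πiα)^n : n ∈ ℤ}` of `ℂ*`. -/
def Gam (α : ℝ) : Set ℂ := {w : ℂ | ∃ n : ℤ, w = qexp α ^ n}

/-- The additive subgroup `ℤ θ + ℤ = {m θ + n : m, n ∈ ℤ}` of `ℝ`. -/
def Zlat (θ : ℝ) : Set ℝ := {x : ℝ | ∃ m n : ℤ, x = (m : ℝ) * θ + (n : ℝ)}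

theorem exp_mem_Gam_iff (α : ℝ) (w : ℂ) :
    Complex.exp w ∈ Gam α ↔ ∃ s ∈ Zlat α, w = 2 * (Real.pi : ℂ) * Complex.I * (s : ℂ) := by
  constructor
  · rintro ⟨n, hn⟩
    rw [qexp, ← Complex.exp_int_mul, Complex.exp_eq_exp_iff_exists_int] at hn
    obtain ⟨k, hk⟩ := hn
    refine ⟨n * α + k, ⟨n, k, rfl⟩, ?_⟩
    rw [hk]
    push_cast
    ring
  · rintro ⟨_, ⟨n, k, rfl⟩, rfl⟩
    refine ⟨n, ?_⟩
    rw [qexp, ← Complex.exp_int_mul, Complex.exp_eq_exp_iff_exists_int]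
    refine ⟨k, ?_⟩
    push_cast
    ring

theorem exp_two_pi_I_mul_mem_Gam_iff (α s : ℝ) :
    Complex.exp (2 * (Real.pi : ℂ) * Complex.I * (s : ℂ)) ∈ Gam α ↔ s ∈ Zlat α := by
  rw [exp_mem_Gam_iff]
  constructor
  · rintro ⟨t, ht, h⟩
    have hst : s = t := by
      exact_mod_cast mul_left_cancel₀ Complex.two_pi_I_ne_zero h
    exact hst ▸ ht
  · exact fun hs => ⟨s, hs, rfl⟩

theorem stmt2 (θ₁ θ₂ : ℝ) (h1 : Irrational θ₁) (h2 : Irrational θ₂)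
    (θ : ℝ) (hθ : θ ≠ 0) :
    (∀ x x' y y' : ℂ, x ≠ 0 → x' ≠ 0 → y ≠ 0 → y' ≠ 0 →
        Crel θ x y → Crel θ x' y' → (x' / x ∈ Gam θ₁ ↔ y' / y ∈ Gam θ₂)) ↔
    (fun s : ℝ => θ * s) '' Zlat θ₁ = Zlat θ₂ := by
  have hθ' : (θ : ℂ) ≠ 0 := by exact_mod_cast hθ
  constructor
  · intro h
    have key : ∀ s : ℝ, s ∈ Zlat θ₁ ↔ θ * s ∈ Zlat θ₂ := by
      intro s
      have := h 1 (Complex.exp (2 * (Real.pi : ℂ) * Complex.I * (s : ℂ))) 1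
        (Complex.exp ((θ : ℂ) * (2 * (Real.pi : ℂ) * Complex.I * (s : ℂ))))
        one_ne_zero (Complex.exp_ne_zero _) one_ne_zero (Complex.exp_ne_zero _)
        ⟨0, by simp, by simp⟩ ⟨_, rfl, rfl⟩
      rw [div_one, div_one, exp_two_pi_I_mul_mem_Gam_iff, mul_left_comm (θ : ℂ),
        ← Complex.ofReal_mul, exp_two_pi_I_mul_mem_Gam_iff] at this
      exact this
    ext t
    constructor
    · rintro ⟨s, hs, rfl⟩
      exact (key s).1 hs
    · intro ht
      refine ⟨t / θ, (key _).2 ?_, mul_div_cancel₀ t hθ⟩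
      rwa [mul_div_cancel₀ t hθ]
  · rintro h _ _ _ _ - - - - ⟨z, rfl, rfl⟩ ⟨z', rfl, rfl⟩
    rw [← Complex.exp_sub, ← Complex.exp_sub, ← mul_sub, exp_mem_Gam_iff, exp_mem_Gam_iff, ← h]
    constructor
    · rintro ⟨s, hs, e⟩
      refine ⟨θ * s, ⟨s, hs, rfl⟩, ?_⟩
      rw [e]
      push_cast
      ring
    · rintro ⟨_, ⟨s, hs, rfl⟩, e⟩
      refine ⟨s, hs, mul_left_cancel₀ hθ' ?_⟩
      rw [e]
      push_cast
      ring
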